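/- Let P = ⟨A | R⟩ be a finite presentation and let C := max{ℓ(r) : r ∈ R}. Let S be a P-sequence w₀, w₁, …, w_m. Then there exists another P-sequence Ŝ, say ŵ₀, ŵ₁, …, ŵ_{m̂}, such that ŵ₀ = w₀ and ŵ_{m̂} = w_m, Area(Ŝ) = Area(S), FL(Ŝ) ≤ FL(S) + C, and every application-of-a-relator move in Ŝ consists of inserting into the word the whole of a cyclic conjugate of an element of R or of an inverse of an element of R (i.e., ŵ_{i+1} = αrβ where ŵ_i = αβ and r is such a cyclic conjugate). -/

import Mathlib

/-- A word over the alphabet `A`: a list of letters `(a, b)`, where the boolean `b`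
records whether the letter is the generator `a` (when `true`) or its formal
inverse `a⁻¹` (when `false`). -/
abbrev Word (A : Type) := List (A × Bool)

/-- The formal inverse of a word. -/
def wordInv {A : Type} (w : Word A) : Word A := (w.map (fun p => (p.1, !p.2))).reverse

/-- `IsCyclicConj v w` : the word `v` is a cyclic conjugate of the word `w`. -/
def IsCyclicConj {A : Type} (v w : Word A) : Prop := ∃ p q, w = p ++ q ∧ v = q ++ p

/-- A free reduction (deleting a subword `a a⁻¹`, `a` a generator or an inverse of a
generator) or a free expansion (inserting such a subword). -/
def FreeStep {A : Type} (w w' : Word A) : Prop :=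
  (∃ (α β : Word A) (x : A × Bool), w = α ++ [x, (x.1, !x.2)] ++ β ∧ w' = α ++ β) ∨
  (∃ (α β : Word A) (x : A × Bool), w = α ++ β ∧ w' = α ++ [x, (x.1, !x.2)] ++ β)

/-- An application of a relator from `R`: replace `w = αuβ` by `w' = αvβ` where
`u v⁻¹` is a cyclic conjugate of an element of `R` or of the inverse of an element
of `R`. -/
def RelStep {A : Type} (R : Set (Word A)) (w w' : Word A) : Prop :=
  ∃ (α u v β : Word A), w = α ++ u ++ β ∧ w' = α ++ v ++ β ∧
    ∃ r ∈ R, IsCyclicConj (u ++ wordInv v) r ∨ IsCyclicConj (u ++ wordInv v) (wordInv r)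

/-- A `P`-sequence for the presentation with relator set `R` : a finite sequence of
words `seq 0, seq 1, …, seq len`, each obtained from the previous one by a free
reduction, a free expansion, or an application of a relator.  The field `isRel`
records which steps are applications of relators. -/
structure PSeq {A : Type} (R : Set (Word A)) where
  len : ℕ
  seq : Fin (len + 1) → Word A
  isRel : Fin len → Bool
  step : ∀ i : Fin len,
    if isRel i then RelStep R (seq i.castSucc) (seq i.succ)
    else FreeStep (seq i.castSucc) (seq i.succ)

/-- The area of a `P`-sequence: the number of application-of-a-relator moves. -/
def PSeq.area {A : Type} {R : Set (Word A)} (S : PSeq R) : ℕ :=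
  (Finset.univ.filter (fun i => S.isRel i = true)).card

/-- The filling length of a `P`-sequence: the maximum of the lengths of its words. -/
def PSeq.fl {A : Type} {R : Set (Word A)} (S : PSeq R) : ℕ :=
  Finset.univ.sup (fun i => (S.seq i).length)

/-- The height of a `P`-sequence: its number of moves. -/
def PSeq.height {A : Type} {R : Set (Word A)} (S : PSeq R) : ℕ := S.len

/-- `S` is a null-`P`-sequence for the word `w`: it starts at `w` and ends at the
empty word. -/
def IsNullSeq {A : Type} {R : Set (Word A)} (S : PSeq R) (w : Word A) : Prop :=
  S.seq 0 = w ∧ S.seq (Fin.last S.len) = []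

section Words

variable {A : Type}

lemma wordInv_append (u v : Word A) : wordInv (u ++ v) = wordInv v ++ wordInv u := by
  simp [wordInv]

lemma wordInv_wordInv (u : Word A) : wordInv (wordInv u) = u := by
  simp [wordInv, Function.comp_def]

lemma length_wordInv (u : Word A) : (wordInv u).length = u.length := by
  simp [wordInv]

lemma IsCyclicConj.wordInv {v w : Word A} (h : IsCyclicConj v w) :
    IsCyclicConj (wordInv v) (wordInv w) := by
  obtain ⟨p, q, rfl, rfl⟩ := h
  exact ⟨_, _, wordInv_append p q, wordInv_append q p⟩

lemma IsCyclicConj.length_eq {v w : Word A} (h : IsCyclicConj v w) : v.length = w.length := by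
  obtain ⟨p, q, rfl, rfl⟩ := h
  simp [Nat.add_comm]

/-- The word `v` is a cyclic conjugate of an element of `R` or of the inverse of one. -/
def IsRelatorConj (R : Set (Word A)) (v : Word A) : Prop :=
  ∃ r ∈ R, IsCyclicConj v r ∨ IsCyclicConj v (wordInv r)

lemma IsRelatorConj.wordInv {R : Set (Word A)} {v : Word A} (h : IsRelatorConj R v) :
    IsRelatorConj R (wordInv v) := by
  obtain ⟨r, hr, h | h⟩ := h
  · exact ⟨r, hr, Or.inr h.wordInv⟩
  · exact ⟨r, hr, Or.inl (by simpa only [wordInv_wordInv] using h.wordInv)⟩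

lemma IsRelatorConj.length_le {R : Finset (Word A)} {v : Word A}
    (h : IsRelatorConj (R : Set (Word A)) v) : v.length ≤ R.sup List.length := by
  obtain ⟨r, hr, h⟩ := h
  have hv : v.length = r.length := by
    rcases h with h | h
    · exact h.length_eq
    · exact h.length_eq.trans (length_wordInv r)
  exact hv ▸ Finset.le_sup (f := List.length) hr

/-- Insertion of a whole cyclic conjugate of a relator or of the inverse of a relator. -/
def InsertStep (R : Set (Word A)) (w w' : Word A) : Prop :=
  ∃ α β r' : Word A, w = α ++ β ∧ w' = α ++ r' ++ β ∧ IsRelatorConj R r'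

lemma InsertStep.relStep {R : Set (Word A)} {w w' : Word A} (h : InsertStep R w w') :
    RelStep R w w' := by
  obtain ⟨α, β, r', rfl, rfl, hr⟩ := h
  exact ⟨α, [], r', β, by simp, rfl, hr.wordInv⟩

/-- `InsertPath R N k w w'`: the word `w` can be transformed into `w'` through words of length
at most `N`, by free reductions, free expansions and exactly `k` insertions of relators. -/
inductive InsertPath (R : Set (Word A)) (N : ℕ) : ℕ → Word A → Word A → Prop
  | nil {w : Word A} : w.length ≤ N → InsertPath R N 0 w w
  | free {k : ℕ} {w w₁ w₂ : Word A} :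
      w.length ≤ N → FreeStep w w₁ → InsertPath R N k w₁ w₂ → InsertPath R N k w w₂
  | insert {k : ℕ} {w w₁ w₂ : Word A} :
      w.length ≤ N → InsertStep R w w₁ → InsertPath R N k w₁ w₂ → InsertPath R N (k + 1) w w₂

/-- A subword `u⁻¹ u` can be removed by free reductions. -/
lemma InsertPath.cancel {R : Set (Word A)} {N k : ℕ} (u : Word A) {α β w : Word A}
    (hN : (α ++ wordInv u ++ u ++ β).length ≤ N) (h : InsertPath R N k (α ++ β) w) :
    InsertPath R N k (α ++ wordInv u ++ u ++ β) w := by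
  induction u generalizing α β with
  | nil => simpa [wordInv] using h
  | cons x u ih =>
    refine .free hN (w₁ := α ++ wordInv u ++ u ++ β) (Or.inl
      ⟨α ++ wordInv u, u ++ β, (x.1, !x.2), ?_, ?_⟩) (ih ?_ h)
    · simp [wordInv]
    · simp
    · simp [length_wordInv] at hN ⊢
      omega

/-- An application of a relator is an insertion of a relator followed by free reductions. -/
lemma InsertPath.of_relStep {R : Finset (Word A)} {M k : ℕ} {w w₁ w₂ : Word A}
    (hw : w.length ≤ M) (hs : RelStep (R : Set (Word A)) w w₁)
    (h : InsertPath (R : Set (Word A)) (M + R.sup List.length) k w₁ w₂) :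
    InsertPath (R : Set (Word A)) (M + R.sup List.length) (k + 1) w w₂ := by
  obtain ⟨α, u, v, β, rfl, rfl, hr⟩ := hs
  replace hr : IsRelatorConj (R : Set (Word A)) (u ++ wordInv v) := hr
  have hlen := hr.length_le
  refine .insert (by omega) (w₁ := (α ++ v) ++ wordInv u ++ u ++ β)
    ⟨α, u ++ β, v ++ wordInv u, by simp, by simp, ?_⟩ (InsertPath.cancel u ?_ h)
  · simpa only [wordInv_append, wordInv_wordInv] using hr.wordInv
  · simp [length_wordInv] at hw hlen ⊢
    omega

lemma InsertPath.of_seq {R : Finset (Word A)} {M : ℕ} (n : ℕ) (seq : Fin (n + 1) → Word A)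
    (isRel : Fin n → Bool)
    (step : ∀ i : Fin n, if isRel i then RelStep (R : Set (Word A)) (seq i.castSucc) (seq i.succ)
      else FreeStep (seq i.castSucc) (seq i.succ))
    (hM : ∀ i, (seq i).length ≤ M) :
    InsertPath (R : Set (Word A)) (M + R.sup List.length)
      (Finset.univ.filter (fun i => isRel i = true)).card (seq 0) (seq (Fin.last n)) := by
  induction n with
  | zero => exact .nil ((hM 0).trans (Nat.le_add_right _ _))
  | succ n ih =>
    have htail := ih (fun i => seq i.succ) (fun i => isRel i.succ) (fun i => step i.succ)
      (fun i => hM i.succ)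
    have hstep := step 0
    rw [Fin.card_filter_univ_succ]
    cases h0 : isRel 0 with
    | true =>
      rw [h0] at hstep
      exact .of_relStep (hM 0) (by simpa using hstep) htail
    | false =>
      rw [h0] at hstep
      exact .free ((hM 0).trans (Nat.le_add_right _ _)) (by simpa using hstep) htail

/-- Prepend a word and a move to a `P`-sequence. -/
def PSeq.cons {R : Set (Word A)} (w : Word A) (b : Bool) (T : PSeq R)
    (h : if b then RelStep R w (T.seq 0) else FreeStep w (T.seq 0)) : PSeq R where
  len := T.len + 1
  seq := Fin.cons w T.seq
  isRel := Fin.cons b T.isRel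
  step := Fin.cases h T.step

lemma PSeq.area_cons {R : Set (Word A)} (w : Word A) (b : Bool) (T : PSeq R)
    (h : if b then RelStep R w (T.seq 0) else FreeStep w (T.seq 0)) :
    (T.cons w b h).area = if b then T.area + 1 else T.area :=
  Fin.card_filter_univ_succ
    (fun i => (Fin.cons b T.isRel : Fin (T.len + 1) → Bool) i = true)

lemma PSeq.fl_le_iff {R : Set (Word A)} (T : PSeq R) (N : ℕ) :
    T.fl ≤ N ↔ ∀ i, (T.seq i).length ≤ N := by
  simp [PSeq.fl]

lemma PSeq.fl_cons_le {R : Set (Word A)} {w : Word A} {b : Bool} {T : PSeq R}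
    {h : if b then RelStep R w (T.seq 0) else FreeStep w (T.seq 0)} {N : ℕ}
    (hw : w.length ≤ N) (hT : T.fl ≤ N) : (T.cons w b h).fl ≤ N :=
  (PSeq.fl_le_iff _ N).2 (Fin.cases hw ((PSeq.fl_le_iff T N).1 hT))

lemma InsertPath.exists_pSeq {R : Set (Word A)} {N k : ℕ} {w w' : Word A}
    (h : InsertPath R N k w w') :
    ∃ T : PSeq R, T.seq 0 = w ∧ T.seq (Fin.last T.len) = w' ∧ T.area = k ∧ T.fl ≤ N ∧
      ∀ i : Fin T.len, T.isRel i = true → InsertStep R (T.seq i.castSucc) (T.seq i.succ) := by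
  induction h with
  | @nil w hw =>
    exact ⟨⟨0, fun _ => w, Fin.elim0, fun i => i.elim0⟩, rfl, rfl, rfl,
      (PSeq.fl_le_iff _ N).2 fun _ => hw, fun i => i.elim0⟩
  | @free k w w₁ w₂ hw hs _ ih =>
    obtain ⟨T, rfl, hl, ha, hf, hi⟩ := ih
    refine ⟨T.cons w false (by simpa using hs), rfl, hl, ?_, PSeq.fl_cons_le hw hf,
      Fin.cases (fun h => Bool.noConfusion h) hi⟩
    simpa [PSeq.area_cons] using ha
  | @insert k w w₁ w₂ hw hs _ ih =>
    obtain ⟨T, rfl, hl, ha, hf, hi⟩ := ih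
    refine ⟨T.cons w true hs.relStep, rfl, hl, ?_, PSeq.fl_cons_le hw hf,
      Fin.cases (fun _ => hs) hi⟩
    simpa [PSeq.area_cons] using ha

end Words

/-- **Lemma.**  Let `⟨A ∣ R⟩` be a finite presentation, `C := max{ℓ(r) : r ∈ R}`,
and `S` a `P`-sequence.  Then there is a `P`-sequence `Ŝ` with the same first and
last words, with `Area(Ŝ) = Area(S)` and `FL(Ŝ) ≤ FL(S) + C`, in which every
application-of-a-relator move is the insertion of the whole of a cyclic conjugate of
an element of `R` or of an inverse of an element of `R`. -/
theorem relator_moves_are_insertions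
    {A : Type} [Fintype A] (R : Finset (Word A)) (S : PSeq (R : Set (Word A))) :
    ∃ T : PSeq (R : Set (Word A)),
      T.seq 0 = S.seq 0 ∧
      T.seq (Fin.last T.len) = S.seq (Fin.last S.len) ∧
      T.area = S.area ∧
      T.fl ≤ S.fl + R.sup List.length ∧
      ∀ i : Fin T.len, T.isRel i = true →
        ∃ (α β r' : Word A), T.seq i.castSucc = α ++ β ∧ T.seq i.succ = α ++ r' ++ β ∧
          ∃ r ∈ R, IsCyclicConj r' r ∨ IsCyclicConj r' (wordInv r) := by
  exact (InsertPath.of_seq S.len S.seq S.isRel S.step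
    ((PSeq.fl_le_iff S S.fl).1 le_rfl)).exists_pSeq
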